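/- Let n ≥ 2 and k ≥ 1 be integers, B = [0,1]ⁿ ⊂ ℝⁿ, and let f : ℝⁿ → ℝ be a positive C^k function which equals 1 on every codimension-two face of B, i.e. f(x) = 1 whenever at least two coordinates of x lie in {0,1} and all coordinates of x lie in [0,1]. Then there exists a C^k diffeomorphism v : ℝⁿ → ℝⁿ such that det(Dv(x)) · f(v(x)) = 1 for all x ∈ ∂B and v(x) = x for all x ∈ ∂B. -/

import Mathlib

open Set

theorem natCast_withTop_ne_zero {k : ℕ} (hk : 1 ≤ k) : ((k : ℕ∞) : WithTop ℕ∞) ≠ 0 := by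
  simp only [ne_eq, Nat.cast_eq_zero, WithTop.coe_eq_zero]
  omega

/-- A `C^k` self-map of `E` with a two-sided `C^k` inverse. -/
def IsContDiffDiffeo {E : Type*} [NormedAddCommGroup E] [NormedSpace ℝ E] (k : ℕ)
    (v : E → E) : Prop :=
  ContDiff ℝ (k : ℕ∞) v ∧
    ∃ w, ContDiff ℝ (k : ℕ∞) w ∧ Function.LeftInverse w v ∧ Function.RightInverse w v

theorem IsContDiffDiffeo.id {E : Type*} [NormedAddCommGroup E] [NormedSpace ℝ E] (k : ℕ) :
    IsContDiffDiffeo k (fun x : E => x) :=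
  ⟨contDiff_id, fun x => x, contDiff_id, fun _ => rfl, fun _ => rfl⟩

theorem IsContDiffDiffeo.comp {E : Type*} [NormedAddCommGroup E] [NormedSpace ℝ E] {k : ℕ}
    {u v : E → E} (hu : IsContDiffDiffeo k u) (hv : IsContDiffDiffeo k v) :
    IsContDiffDiffeo k (u ∘ v) := by
  obtain ⟨hu, u', hu', hul, hur⟩ := hu
  obtain ⟨hv, v', hv', hvl, hvr⟩ := hv
  exact ⟨hu.comp hv, v' ∘ u', hv'.comp hu', hul.comp hvl, hur.comp hvr⟩

/-- Global inverse function theorem for bijections with nonvanishing Jacobian determinant. -/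
theorem isContDiffDiffeo_of_bijective {E : Type*} [NormedAddCommGroup E] [NormedSpace ℝ E]
    [FiniteDimensional ℝ E] {k : ℕ} (hk : 1 ≤ k) {v : E → E} (hv : ContDiff ℝ (k : ℕ∞) v)
    (hbij : Function.Bijective v)
    (hdet : ∀ x, LinearMap.det (fderiv ℝ v x).toLinearMap ≠ 0) :
    IsContDiffDiffeo k v := by
  have : CompleteSpace E := FiniteDimensional.complete ℝ E
  have hk0 := natCast_withTop_ne_zero hk
  let v' : E → E ≃L[ℝ] E := fun x =>
    (fderiv ℝ v x).toContinuousLinearEquivOfDetNeZero (hdet x)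
  have hstrict : ∀ x, HasStrictFDerivAt v (v' x : E →L[ℝ] E) x := fun x => by
    simpa [v'] using hv.contDiffAt.hasStrictFDerivAt hk0
  let h : E ≃ₜ E := (Equiv.ofBijective v hbij).toHomeomorphOfContinuousOpen hv.continuous
    (isOpenMap_of_hasStrictFDerivAt_equiv hstrict)
  have hsymm : ContDiff ℝ (k : ℕ∞) h.symm :=
    h.contDiff_symm (f₀' := v') (fun x => (hstrict x).hasFDerivAt) hv
  exact ⟨hv, h.symm, hsymm, h.symm_apply_apply, h.apply_symm_apply⟩

/-- The Jacobian determinant is multiplicative under composition. -/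
theorem det_fderiv_comp {E : Type*} [NormedAddCommGroup E] [NormedSpace ℝ E] {u v : E → E}
    {x : E} (hu : DifferentiableAt ℝ u (v x)) (hv : DifferentiableAt ℝ v x) :
    LinearMap.det (fderiv ℝ (u ∘ v) x).toLinearMap =
      LinearMap.det (fderiv ℝ u (v x)).toLinearMap *
        LinearMap.det (fderiv ℝ v x).toLinearMap := by
  rw [fderiv_comp x hu hv, ContinuousLinearMap.toLinearMap_comp, LinearMap.det_comp]

/-- A perturbation of the identity of `ℝ` fixing `0` and `1`, with derivative `1 - a` at `0` and
`1 - b` at `1`. -/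
noncomputable def sineProfile (a b t : ℝ) : ℝ :=
  t - a * (Real.sin (Real.pi * t) / (2 * Real.pi) + Real.sin (2 * Real.pi * t) / (4 * Real.pi))
    - b * (-Real.sin (Real.pi * t) / (2 * Real.pi) + Real.sin (2 * Real.pi * t) / (4 * Real.pi))

/-- The derivative of `sineProfile a b` at `t`. -/
noncomputable def sineProfileDeriv (a b t : ℝ) : ℝ :=
  1 - a * ((Real.cos (Real.pi * t) + Real.cos (2 * Real.pi * t)) / 2)
    - b * ((-Real.cos (Real.pi * t) + Real.cos (2 * Real.pi * t)) / 2)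

theorem hasDerivAt_sineProfile (a b t : ℝ) :
    HasDerivAt (sineProfile a b) (sineProfileDeriv a b t) t := by
  have h1 : HasDerivAt (fun t => Real.sin (Real.pi * t))
      (Real.cos (Real.pi * t) * (Real.pi * 1)) t := ((hasDerivAt_id t).const_mul Real.pi).sin
  have h2 : HasDerivAt (fun t => Real.sin (2 * Real.pi * t))
      (Real.cos (2 * Real.pi * t) * (2 * Real.pi * 1)) t :=
    ((hasDerivAt_id t).const_mul (2 * Real.pi)).sin
  have h := ((hasDerivAt_id t).sub
    (((h1.div_const (2 * Real.pi)).add (h2.div_const (4 * Real.pi))).const_mul a)).sub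
    (((h1.neg.div_const (2 * Real.pi)).add (h2.div_const (4 * Real.pi))).const_mul b)
  refine h.congr_deriv ?_
  have := Real.pi_ne_zero
  rw [sineProfileDeriv]
  field_simp
  ring

theorem sineProfileDeriv_pos {a b : ℝ} (ha : a ∈ Ioo (0 : ℝ) 1) (hb : b ∈ Ioo (0 : ℝ) 1)
    (t : ℝ) : 0 < sineProfileDeriv a b t := by
  obtain ⟨ha0, ha1⟩ := ha
  obtain ⟨hb0, hb1⟩ := hb
  have hc : Real.cos (2 * Real.pi * t) = 2 * Real.cos (Real.pi * t) ^ 2 - 1 := by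
    rw [mul_assoc, Real.cos_two_mul]
  rw [sineProfileDeriv, hc]
  have h1 := Real.neg_one_le_cos (Real.pi * t)
  have h2 := Real.cos_le_one (Real.pi * t)
  set c := Real.cos (Real.pi * t)
  nlinarith [mul_nonneg (sub_nonneg.2 h2) (by linarith : 0 ≤ 1 + c),
    mul_nonneg (mul_nonneg (sub_nonneg.2 h2) (by linarith : 0 ≤ 1 + c)) (add_pos ha0 hb0).le,
    mul_nonneg (sub_nonneg.2 h2) (sub_pos.2 hb1).le,
    mul_nonneg (by linarith : 0 ≤ 1 + c) (sub_pos.2 ha1).le]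

theorem strictMono_sineProfile {a b : ℝ} (ha : a ∈ Ioo (0 : ℝ) 1) (hb : b ∈ Ioo (0 : ℝ) 1) :
    StrictMono (sineProfile a b) :=
  strictMono_of_hasDerivAt_pos (hasDerivAt_sineProfile a b) (sineProfileDeriv_pos ha hb)

theorem abs_sineProfile_sub_le (a b t : ℝ) : |sineProfile a b t - t| ≤ |a| + |b| := by
  have hpi := Real.pi_gt_three
  have key : ∀ s u : ℝ, |s| ≤ 1 → |u| ≤ 1 →
      |s / (2 * Real.pi) + u / (4 * Real.pi)| ≤ 1 := fun s u hs hu => by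
    rw [abs_le] at hs hu ⊢
    rw [div_add_div _ _ (by positivity) (by positivity), le_div_iff₀ (by positivity),
      div_le_iff₀ (by positivity)]
    constructor <;> nlinarith
  have hA := key _ _ (Real.abs_sin_le_one (Real.pi * t)) (Real.abs_sin_le_one (2 * Real.pi * t))
  have hB := key (-Real.sin (Real.pi * t)) _ (by simpa using Real.abs_sin_le_one (Real.pi * t))
    (Real.abs_sin_le_one (2 * Real.pi * t))
  calc |sineProfile a b t - t|
      = |a * (Real.sin (Real.pi * t) / (2 * Real.pi) + Real.sin (2 * Real.pi * t) / (4 * Real.pi))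
        + b * (-Real.sin (Real.pi * t) / (2 * Real.pi)
          + Real.sin (2 * Real.pi * t) / (4 * Real.pi))| := by
        rw [← abs_neg, sineProfile]; congr 1; ring
    _ ≤ |a| * 1 + |b| * 1 := by
        refine (abs_add_le _ _).trans ?_
        rw [abs_mul, abs_mul]
        gcongr
    _ = |a| + |b| := by ring

theorem surjective_sineProfile (a b : ℝ) : Function.Surjective (sineProfile a b) := by
  have hcont : Continuous (sineProfile a b) :=
    continuous_iff_continuousAt.2 fun t => (hasDerivAt_sineProfile a b t).continuousAt
  refine hcont.surjective ?_ ?_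
  · refine Filter.tendsto_atTop_mono (f := fun t => t + -(|a| + |b|)) (fun t => ?_)
      (Filter.tendsto_atTop_add_const_right _ _ Filter.tendsto_id)
    linarith [(abs_le.1 (abs_sineProfile_sub_le a b t)).1]
  · refine Filter.tendsto_atBot_mono (f := fun t => t + (|a| + |b|)) (fun t => ?_)
      (Filter.tendsto_atBot_add_const_right _ _ Filter.tendsto_id)
    linarith [(abs_le.1 (abs_sineProfile_sub_le a b t)).2]

@[simp] theorem sineProfile_zero (a b : ℝ) : sineProfile a b 0 = 0 := by simp [sineProfile]

@[simp] theorem sineProfile_one (a b : ℝ) : sineProfile a b 1 = 1 := by simp [sineProfile]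

@[simp] theorem sineProfileDeriv_zero (a b : ℝ) : sineProfileDeriv a b 0 = 1 - a := by
  simp [sineProfileDeriv]

@[simp] theorem sineProfileDeriv_one (a b : ℝ) : sineProfileDeriv a b 1 = 1 - b := by
  simp [sineProfileDeriv]

section CoordinateShear

variable {ι : Type*} [DecidableEq ι]

/-- The self-map of `ℝ^ι` moving the `i`-th coordinate by the profile whose parameters are the
values of `g` at the projections of the point to the hyperplanes `x i = 0` and `x i = 1`. -/
noncomputable def coordinateShear (g : (ι → ℝ) → ℝ) (i : ι) (x : ι → ℝ) : ι → ℝ :=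
  Function.update x i
    (sineProfile (g (Function.update x i 0)) (g (Function.update x i 1)) (x i))

theorem coordinateShear_update (g : (ι → ℝ) → ℝ) (i : ι) (x : ι → ℝ) (t : ℝ) :
    coordinateShear g i (Function.update x i t) = Function.update x i
      (sineProfile (g (Function.update x i 0)) (g (Function.update x i 1)) t) := by
  simp [coordinateShear]

theorem coordinateShear_eq_self (g : (ι → ℝ) → ℝ) {i : ι} {x : ι → ℝ} (hx : x i = 0 ∨ x i = 1) :
    coordinateShear g i x = x := by
  rcases hx with hx | hx <;> simp [coordinateShear, hx]

theorem update_coordinateShear (g : (ι → ℝ) → ℝ) (i : ι) (x : ι → ℝ) (t : ℝ) :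
    Function.update (coordinateShear g i x) i t = Function.update x i t := by
  simp [coordinateShear]

theorem bijective_coordinateShear {g : (ι → ℝ) → ℝ} (hg : ∀ x, g x ∈ Ioo (0 : ℝ) 1) (i : ι) :
    Function.Bijective (coordinateShear g i) := by
  constructor
  · intro x y hxy
    have hup : ∀ t, Function.update x i t = Function.update y i t := fun t => by
      rw [← update_coordinateShear g i x, hxy, update_coordinateShear]
    have hi := congrFun hxy i
    simp only [coordinateShear, Function.update_self, hup] at hi
    rw [← Function.update_eq_self i x, (strictMono_sineProfile (hg _) (hg _)).injective hi, hup,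
      Function.update_eq_self]
  · intro y
    obtain ⟨t, ht⟩ := surjective_sineProfile (g (Function.update y i 0))
      (g (Function.update y i 1)) (y i)
    exact ⟨Function.update y i t, by rw [coordinateShear_update, ht, Function.update_eq_self]⟩

variable [Fintype ι]

theorem contDiff_update_const {k : WithTop ℕ∞} (i : ι) (c : ℝ) :
    ContDiff ℝ k (fun x : ι → ℝ => Function.update x i c) := by
  rw [contDiff_pi]
  intro j
  by_cases h : j = i
  · subst h
    simpa using contDiff_const
  · simpa [h] using contDiff_apply ℝ ℝ j

theorem contDiff_coordinateShear {g : (ι → ℝ) → ℝ} {k : WithTop ℕ∞} (hg : ContDiff ℝ k g)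
    (i : ι) : ContDiff ℝ k (coordinateShear g i) := by
  rw [contDiff_pi]
  intro j
  by_cases h : j = i
  · subst h
    have h0 : ContDiff ℝ k fun x : ι → ℝ => g (Function.update x j 0) :=
      hg.comp (contDiff_update_const j 0)
    have h1 : ContDiff ℝ k fun x : ι → ℝ => g (Function.update x j 1) :=
      hg.comp (contDiff_update_const j 1)
    have hx : ContDiff ℝ k fun x : ι → ℝ => x j := contDiff_apply ℝ ℝ j
    simp only [coordinateShear, Function.update_self, sineProfile]
    have hsin : ∀ c : ℝ, ContDiff ℝ k fun x : ι → ℝ => Real.sin (c * x j) := fun c =>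
      Real.contDiff_sin.comp (contDiff_const.mul hx)
    exact (hx.sub (h0.mul (((hsin _).div_const _).add ((hsin _).div_const _)))).sub
      (h1.mul (((hsin _).neg.div_const _).add ((hsin _).div_const _)))
  · simpa [coordinateShear, h] using contDiff_apply ℝ ℝ j

theorem det_fderiv_coordinateShear {g : (ι → ℝ) → ℝ} {x : ι → ℝ} {i : ι}
    (hg : DifferentiableAt ℝ (coordinateShear g i) x) :
    LinearMap.det (fderiv ℝ (coordinateShear g i) x).toLinearMap =
      sineProfileDeriv (g (Function.update x i 0)) (g (Function.update x i 1)) (x i) := by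
  have hcomp : ∀ j, HasFDerivAt (fun y => coordinateShear g i y j)
      ((ContinuousLinearMap.proj j).comp (fderiv ℝ (coordinateShear g i) x)) x :=
    hasFDerivAt_pi'.1 hg.hasFDerivAt
  let l : Module.Dual ℝ (ι → ℝ) :=
    ((ContinuousLinearMap.proj (R := ℝ) (φ := fun _ : ι => ℝ) i).comp
      (fderiv ℝ (coordinateShear g i) x)).toLinearMap - LinearMap.proj i
  have htrans : (fderiv ℝ (coordinateShear g i) x).toLinearMap =
      LinearMap.transvection l (Pi.single i 1) := by
    refine LinearMap.ext fun z => funext fun j => ?_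
    rw [LinearMap.transvection.apply]
    by_cases h : j = i
    · subst h
      simp [l]
    · have hproj : HasFDerivAt (fun y => coordinateShear g i y j)
          (ContinuousLinearMap.proj (R := ℝ) (φ := fun _ : ι => ℝ) j) x := by
        have : (fun y => coordinateShear g i y j) = fun y => y j := by
          funext y; simp [coordinateShear, h]
        rw [this]
        exact (ContinuousLinearMap.proj (R := ℝ) (φ := fun _ : ι => ℝ) j).hasFDerivAt
      have := congrArg (fun L : (ι → ℝ) →L[ℝ] ℝ => L z) ((hcomp j).unique hproj)
      simpa [h] using this
  have hline : HasDerivAt (fun t => coordinateShear g i (Function.update x i t) i)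
      (fderiv ℝ (coordinateShear g i) x (Pi.single i 1) i) (x i) := by
    have h := HasFDerivAt.comp_hasDerivAt_of_eq (x i) (hcomp i) (hasDerivAt_update x i (x i))
      (Function.update_eq_self i x).symm
    exact h
  have hderiv := hline.unique (f₁' := sineProfileDeriv (g (Function.update x i 0))
      (g (Function.update x i 1)) (x i)) (by
    simpa [coordinateShear_update] using hasDerivAt_sineProfile _ _ (x i))
  rw [htrans, LinearMap.transvection.det, ← hderiv]
  simp [l]

theorem isContDiffDiffeo_coordinateShear {g : (ι → ℝ) → ℝ} {k : ℕ} (hk : 1 ≤ k)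
    (hg : ContDiff ℝ (k : ℕ∞) g) (hg01 : ∀ x, g x ∈ Ioo (0 : ℝ) 1) (i : ι) :
    IsContDiffDiffeo k (coordinateShear g i) := by
  have hk0 := natCast_withTop_ne_zero hk
  have hd := contDiff_coordinateShear hg i
  refine isContDiffDiffeo_of_bijective hk hd (bijective_coordinateShear hg01 i) fun x => ?_
  rw [det_fderiv_coordinateShear (hd.differentiable hk0 x)]
  exact (sineProfileDeriv_pos (hg01 _) (hg01 _) _).ne'

end CoordinateShear

theorem mem_frontier_unitCube {ι : Type*} [Fintype ι] {x : ι → ℝ}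
    (hx : x ∈ frontier (Icc (0 : ι → ℝ) 1)) :
    x ∈ Icc (0 : ι → ℝ) 1 ∧ ∃ j, x j = 0 ∨ x j = 1 := by
  rw [isClosed_Icc.frontier_eq] at hx
  refine ⟨hx.1, ?_⟩
  by_contra! h
  apply hx.2
  rw [← pi_univ_Icc, interior_pi_set finite_univ]
  intro j _
  simp only [interior_Icc]
  exact ⟨lt_of_le_of_ne (hx.1.1 j) (h j).1.symm, lt_of_le_of_ne (hx.1.2 j) (h j).2⟩

/-- A diffeomorphism fixing the boundary of the unit cube whose Jacobian determinant is `1 / f` on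
the two faces orthogonal to the `i`-th axis and `1` on the other faces. -/
theorem exists_diffeo_prescribed_on_opposite_faces {ι : Type*} [Fintype ι] [DecidableEq ι] {k : ℕ}
    (hk : 1 ≤ k) {f : (ι → ℝ) → ℝ} (hf : ContDiff ℝ (k : ℕ∞) f) (hfpos : ∀ x, 0 < f x)
    (hfaces : ∀ x : ι → ℝ, x ∈ Icc (0 : ι → ℝ) 1 →
      (∃ i j : ι, i ≠ j ∧ (x i = 0 ∨ x i = 1) ∧ (x j = 0 ∨ x j = 1)) → f x = 1) (i : ι) :
    ∃ v : (ι → ℝ) → (ι → ℝ), IsContDiffDiffeo k v ∧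
      (∀ x ∈ frontier (Icc (0 : ι → ℝ) 1), v x = x) ∧
      ∀ x ∈ frontier (Icc (0 : ι → ℝ) 1),
        LinearMap.det (fderiv ℝ v x).toLinearMap *
          (if x i ∈ ({0, 1} : Set ℝ) then f x else 1) = 1 := by
  have hk0 := natCast_withTop_ne_zero hk
  have hne : ∀ x, 1 + f x ≠ 0 := fun x => by linarith [hfpos x]
  let g : (ι → ℝ) → ℝ := fun x => f x / (1 + f x)
  let h : (ι → ℝ) → ℝ := fun x => 1 / (1 + f x)
  have hg : ContDiff ℝ (k : ℕ∞) g := hf.div (contDiff_const.add hf) hne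
  have hh : ContDiff ℝ (k : ℕ∞) h := contDiff_const.div (contDiff_const.add hf) hne
  have hg01 : ∀ x, g x ∈ Ioo (0 : ℝ) 1 := fun x => by
    have := hfpos x
    exact ⟨by positivity, by rw [div_lt_one (by positivity)]; linarith⟩
  have hh01 : ∀ x, h x ∈ Ioo (0 : ℝ) 1 := fun x => by
    have := hfpos x
    exact ⟨by positivity, by rw [div_lt_one (by positivity)]; linarith⟩
  have hG := isContDiffDiffeo_coordinateShear hk hg hg01 i
  have hH := isContDiffDiffeo_coordinateShear hk hh hh01 i
  obtain ⟨hHd, w, hw, hwl, hwr⟩ := hH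
  have hGdiff := hG.1.differentiable hk0
  have hHdiff := hHd.differentiable hk0
  have hwdiff := hw.differentiable hk0
  have hpar : ∀ x ∈ frontier (Icc (0 : ι → ℝ) 1), x i ∉ ({0, 1} : Set ℝ) →
      ∀ c ∈ ({0, 1} : Set ℝ), g (Function.update x i c) = h (Function.update x i c) := by
    intro x hx hxi c hc
    obtain ⟨hxB, j, hj⟩ := mem_frontier_unitCube hx
    have hji : j ≠ i := by
      rintro rfl
      exact hxi hj
    have hc01 : 0 ≤ c ∧ c ≤ 1 := by
      rcases hc with rfl | rfl <;> norm_num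
    have : f (Function.update x i c) = 1 := by
      refine hfaces _ ⟨?_, ?_⟩ ⟨i, j, hji.symm, by simpa using hc, by simpa [hji] using hj⟩
      · exact le_update_iff.2 ⟨hc01.1, fun l _ => hxB.1 l⟩
      · exact update_le_iff.2 ⟨hc01.2, fun l _ => hxB.2 l⟩
    simp [g, h, this]
  have hfixface : ∀ x : ι → ℝ, x i ∈ ({0, 1} : Set ℝ) → w x = x := fun x hx => by
    conv_lhs => rw [← coordinateShear_eq_self h (i := i) (x := x) hx]
    exact hwl x
  have hupw : ∀ x c, Function.update (w x) i c = Function.update x i c := fun x c => by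
    rw [← update_coordinateShear h i (w x), hwr x]
  have hfix : ∀ x ∈ frontier (Icc (0 : ι → ℝ) 1), coordinateShear g i (w x) = x := by
    intro x hx
    by_cases hxi : x i ∈ ({0, 1} : Set ℝ)
    · rw [hfixface x hxi, coordinateShear_eq_self g hxi]
    · conv_rhs => rw [← hwr x]
      simp only [coordinateShear, hupw, hpar x hx hxi 0 (by simp), hpar x hx hxi 1 (by simp)]
  refine ⟨coordinateShear g i ∘ w, hG.comp ⟨hw, _, hHd, hwr, hwl⟩, hfix, fun x hx => ?_⟩
  have hinv : LinearMap.det (fderiv ℝ (coordinateShear h i) (w x)).toLinearMap *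
      LinearMap.det (fderiv ℝ w x).toLinearMap = 1 := by
    rw [← det_fderiv_comp (hHdiff _) (hwdiff x), hwr.comp_eq_id, fderiv_id,
      ContinuousLinearMap.coe_id, LinearMap.det_id]
  rw [det_fderiv_comp (hGdiff _) (hwdiff x), det_fderiv_coordinateShear (hGdiff _)]
  rw [det_fderiv_coordinateShear (hHdiff _)] at hinv
  simp only [hupw] at hinv ⊢
  by_cases hxi : x i ∈ ({0, 1} : Set ℝ)
  · rw [if_pos hxi]
    have hgh : 1 - g x = (1 - h x) / f x := by
      have := (hfpos x).ne'
      have := hne x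
      simp only [g, h]
      field_simp
      ring
    have hfx := (hfpos x).ne'
    rw [hfixface x hxi] at hinv ⊢
    have hup : Function.update x i (x i) = x := Function.update_eq_self i x
    rcases hxi with hxi | hxi <;> rw [hxi] at hinv hup ⊢ <;>
      simp only [sineProfileDeriv_zero, sineProfileDeriv_one, hup] at hinv ⊢ <;>
      rw [hgh] <;> field_simp <;> exact hinv
  · rw [if_neg hxi, mul_one, hpar x hx hxi 0 (by simp), hpar x hx hxi 1 (by simp), hinv]

/-- A diffeomorphism fixing the boundary of the unit cube whose Jacobian determinant is prescribed
on the faces orthogonal to the axes in `s`. -/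
theorem exists_diffeo_prescribed_on_faces {ι : Type*} [Fintype ι] [DecidableEq ι] {k : ℕ}
    (hk : 1 ≤ k) {f : (ι → ℝ) → ℝ} (hf : ContDiff ℝ (k : ℕ∞) f) (hfpos : ∀ x, 0 < f x)
    (hfaces : ∀ x : ι → ℝ, x ∈ Icc (0 : ι → ℝ) 1 →
      (∃ i j : ι, i ≠ j ∧ (x i = 0 ∨ x i = 1) ∧ (x j = 0 ∨ x j = 1)) → f x = 1)
    (s : Finset ι) :
    ∃ v : (ι → ℝ) → (ι → ℝ), IsContDiffDiffeo k v ∧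
      (∀ x ∈ frontier (Icc (0 : ι → ℝ) 1), v x = x) ∧
      ∀ x ∈ frontier (Icc (0 : ι → ℝ) 1),
        LinearMap.det (fderiv ℝ v x).toLinearMap *
          ∏ i ∈ s, (if x i ∈ ({0, 1} : Set ℝ) then f x else 1) = 1 := by
  have hk0 := natCast_withTop_ne_zero hk
  induction s using Finset.induction_on with
  | empty =>
    refine ⟨fun x => x, .id k, fun _ _ => rfl, fun x _ => ?_⟩
    rw [fderiv_fun_id, ContinuousLinearMap.coe_id, LinearMap.det_id, Finset.prod_empty,
      one_mul]
  | insert i s his ih =>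
    obtain ⟨v, hv, hvfix, hvdet⟩ := ih
    obtain ⟨u, hu, hufix, hudet⟩ :=
      exists_diffeo_prescribed_on_opposite_faces hk hf hfpos hfaces i
    refine ⟨u ∘ v, hu.comp hv, fun x hx => ?_, fun x hx => ?_⟩
    · rw [Function.comp_apply, hvfix x hx, hufix x hx]
    · rw [det_fderiv_comp (hu.1.differentiable hk0 _) (hv.1.differentiable hk0 x), hvfix x hx,
        Finset.prod_insert his, mul_mul_mul_comm, hudet x hx, hvdet x hx, one_mul]

/-- **Separation lemma for the hypercube.**  If `f : ℝⁿ → ℝ` is a positive `C^k` function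
equal to `1` on every codimension-two face of `B = [0,1]ⁿ` (i.e. at every point of `B`
with at least two coordinates in `{0,1}`), then there is a `C^k` diffeomorphism `v` of
`ℝⁿ` fixing `∂B` pointwise such that `det(Dv) · (f ∘ v) = 1` on `∂B`. -/
theorem hypercube_separation (n k : ℕ) (hn : 2 ≤ n) (hk : 1 ≤ k)
    (f : (Fin n → ℝ) → ℝ) (hf : ContDiff ℝ (k : ℕ∞) f) (hfpos : ∀ x, 0 < f x)
    (hfaces : ∀ x : Fin n → ℝ, x ∈ Set.Icc (0 : Fin n → ℝ) 1 →
      (∃ i j : Fin n, i ≠ j ∧ (x i = 0 ∨ x i = 1) ∧ (x j = 0 ∨ x j = 1)) → f x = 1) :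
    ∃ v : (Fin n → ℝ) → (Fin n → ℝ),
      ContDiff ℝ (k : ℕ∞) v ∧
      (∃ w, ContDiff ℝ (k : ℕ∞) w ∧ Function.LeftInverse w v ∧ Function.RightInverse w v) ∧
      (∀ x ∈ frontier (Set.Icc (0 : Fin n → ℝ) 1),
        LinearMap.det (fderiv ℝ v x).toLinearMap * f (v x) = 1) ∧
      (∀ x ∈ frontier (Set.Icc (0 : Fin n → ℝ) 1), v x = x) := by
  obtain ⟨v, ⟨hv, hinv⟩, hfix, hdet⟩ :=
    exists_diffeo_prescribed_on_faces hk hf hfpos hfaces Finset.univ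
  refine ⟨v, hv, hinv, fun x hx => ?_, hfix⟩
  rw [hfix x hx]
  obtain ⟨hxB, j, hj⟩ := mem_frontier_unitCube hx
  rw [← hdet x hx]
  congr 1
  rw [Finset.prod_eq_single j, if_pos (show x j ∈ ({0, 1} : Set ℝ) from hj)]
  · intro i _ hij
    split_ifs with hi
    · exact hfaces x hxB ⟨i, j, hij, hi, hj⟩
    · rfl
  · simp
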